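/- arXiv:2005.05907 — 2 statements merged into one kernel-verified Lean document; each statement's English description precedes it below -/
import Mathlib

section
/- Let Σ be a finite alphabet, Γ ⊆ Σ, and L ⊆ Σ* a language such that every nonempty word of L begins with a letter from Σ \ Γ. Let A = (Q, δ) be a deterministic complete semi-automaton over Σ with |Q| > 1. Define the deterministic complete semi-automaton A' over Σ with state set Q ⊔ Q₁, where Q₁ = {q₁ : q ∈ Q} is a disjoint copy of Q, and transitions: δ'(q, x) = δ(q, x) for q ∈ Q and any letter x; δ'(q₁, x) = q₁ for q₁ ∈ Q₁ and x ∈ Γ; and δ'(q₁, x) = δ(q, x) ∈ Q for q₁ ∈ Q₁ and x ∉ Γ. Then A' has a synchronizing word in Γ*·L if and only if A has a synchronizing word in L. -/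
/-- Extended transition function of a deterministic complete semi-automaton. -/
def run {Q σ : Type*} (δ : Q → σ → Q) (q : Q) (w : List σ) : Q := w.foldl δ q

/-- A word is synchronizing for the DCSA `(Q, δ)` if it maps every state to one state. -/
def IsSync {Q σ : Type*} (δ : Q → σ → Q) (w : List σ) : Prop := ∃ q, ∀ p, run δ p w = q

/-- Concatenation of two languages. -/
def conc {σ : Type*} (L M : Set (List σ)) : Set (List σ) :=
  {x | ∃ u ∈ L, ∃ v ∈ M, x = u ++ v}

theorem run_eq_map_run {P Q σ : Type*} {δ : P → σ → P} {δ' : Q → σ → Q} {f : P → Q}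
    (h : ∀ p x, δ' (f p) x = f (δ p x)) (p : P) (w : List σ) :
    run δ' (f p) w = f (run δ p w) := by
  induction w generalizing p with
  | nil => rfl
  | cons x xs ih =>
    change run δ' (δ' (f p) x) xs = f (run δ (δ p x) xs)
    rw [h, ih]

theorem run_eq_self {Q σ : Type*} {δ : Q → σ → Q} {q : Q} {w : List σ}
    (h : ∀ x ∈ w, δ q x = q) : run δ q w = q := by
  induction w with
  | nil => rfl
  | cons x xs ih =>
    change run δ (δ q x) xs = q
    rw [h x (by simp), ih fun y hy => h y (List.mem_cons_of_mem x hy)]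

theorem run_append {Q σ : Type*} (δ : Q → σ → Q) (q : Q) (u v : List σ) :
    run δ q (u ++ v) = run δ (run δ q u) v :=
  List.foldl_append

theorem not_isSync_nil {Q σ : Type*} [Nontrivial Q] (δ : Q → σ → Q) : ¬ IsSync δ [] := by
  rintro ⟨q, hq⟩
  obtain ⟨p, hp⟩ := exists_ne q
  exact hp (hq p)

theorem stmt_10 {σ : Type*} [Fintype σ] (Γ : Set σ) (L : Set (List σ))
    (hL : ∀ w ∈ L, ∀ (x : σ) (xs : List σ), w = x :: xs → x ∉ Γ)
    {Q : Type*} [Fintype Q] [Nonempty Q] (δ : Q → σ → Q)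
    (hcard : 1 < Fintype.card Q)
    (δ' : Q ⊕ Q → σ → Q ⊕ Q)
    (h1 : ∀ (q : Q) (x : σ), δ' (Sum.inl q) x = Sum.inl (δ q x))
    (h2 : ∀ (q : Q) (x : σ), x ∈ Γ → δ' (Sum.inr q) x = Sum.inr q)
    (h3 : ∀ (q : Q) (x : σ), x ∉ Γ → δ' (Sum.inr q) x = Sum.inl (δ q x)) :
    (∃ w ∈ conc {v : List σ | ∀ x ∈ v, x ∈ Γ} L, IsSync δ' w) ↔
    (∃ w ∈ L, IsSync δ w) := by
  have : Nontrivial Q := Fintype.one_lt_card_iff_nontrivial.mp hcard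
  have run_inl (q : Q) (w : List σ) : run δ' (Sum.inl q) w = Sum.inl (run δ q w) :=
    run_eq_map_run h1 q w
  have run_inr (q : Q) {w : List σ} (hw : w ∈ L) (hne : w ≠ []) :
      run δ' (Sum.inr q) w = Sum.inl (run δ q w) := by
    obtain ⟨x, xs, rfl⟩ := List.exists_cons_of_ne_nil hne
    change run δ' (δ' (Sum.inr q) x) xs = Sum.inl (run δ (δ q x) xs)
    rw [h3 q x (hL _ hw x xs rfl), run_inl]
  constructor
  · rintro ⟨_, ⟨u, hu, v, hv, rfl⟩, s, hs⟩
    have hsv (q : Q) : run δ' (Sum.inr q) v = s := by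
      rw [← hs (Sum.inr q), run_append, run_eq_self fun x hx => h2 q x (hu x hx)]
    have hne : v ≠ [] := by
      rintro rfl
      obtain ⟨p, q, hpq⟩ := exists_pair_ne Q
      exact hpq (Sum.inr_injective ((hsv p).trans (hsv q).symm))
    refine ⟨v, hv, run δ (Classical.arbitrary Q) v, fun p => Sum.inl_injective (β := Q) ?_⟩
    rw [← run_inr _ hv hne, ← run_inr _ hv hne, hsv, hsv]
  · rintro ⟨w, hw, hsync⟩
    have hne : w ≠ [] := by
      rintro rfl
      exact not_isSync_nil δ hsync
    obtain ⟨s, hs⟩ := hsync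
    refine ⟨w, ⟨[], by simp, w, hw, rfl⟩, Sum.inl s, ?_⟩
    rintro (q | q)
    · rw [run_inl, hs]
    · rw [run_inr q hw hne, hs]
end

section
/- Let a and b be two distinct letters. For all words v, w over {a, b}: if v·a·w belongs to the Kleene star of the set {a, ba, abb}, then v·a also belongs to the Kleene star of {a, ba, abb}. -/
/-- Kleene star of a language. -/
def kstarSet {σ : Type*} (L : Set (List σ)) : Set (List σ) :=
  {x | ∃ W : List (List σ), (∀ w ∈ W, w ∈ L) ∧ x = W.flatten}

theorem nil_mem_kstarSet {σ : Type*} (L : Set (List σ)) : [] ∈ kstarSet L :=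
  ⟨[], by simp, rfl⟩

theorem append_mem_kstarSet {σ : Type*} {L : Set (List σ)} {x y : List σ}
    (hx : x ∈ L) (hy : y ∈ kstarSet L) : x ++ y ∈ kstarSet L := by
  obtain ⟨W, hW, rfl⟩ := hy
  exact ⟨x :: W, by simpa using ⟨hx, hW⟩, by simp⟩

theorem mem_kstarSet_of_mem {σ : Type*} {L : Set (List σ)} {x : List σ}
    (hx : x ∈ L) : x ∈ kstarSet L := by
  simpa using append_mem_kstarSet hx (nil_mem_kstarSet L)

theorem append_singleton_mem_kstarSet_of_flatten {σ : Type*} {a b : σ} (hab : a ≠ b)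
    (W : List (List σ)) (hW : ∀ u ∈ W, u ∈ ({[a], [b, a], [a, b, b]} : Set (List σ)))
    (v w : List σ) (h : v ++ a :: w = W.flatten) :
    v ++ [a] ∈ kstarSet ({[a], [b, a], [a, b, b]} : Set (List σ)) := by
  induction W generalizing v with
  | nil => simp at h
  | cons u W ih =>
    have ih' := ih fun x hx => hW x (List.mem_cons_of_mem _ hx)
    have hu := hW u List.mem_cons_self
    have hu' := hu
    simp only [Set.mem_insert_iff, Set.mem_singleton_iff] at hu'
    rw [List.flatten_cons, List.append_eq_append_iff] at h
    obtain ⟨t, rfl, ht⟩ | ⟨t, rfl, ht⟩ := h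
    · rcases t with _ | ⟨c, t⟩
      · simp only [List.append_nil] at hu
        exact append_mem_kstarSet hu (ih' [] ht)
      · obtain ⟨rfl, -⟩ := List.cons.inj ht
        apply mem_kstarSet_of_mem
        rcases v with _ | ⟨x, _ | ⟨y, _ | ⟨z, v⟩⟩⟩ <;> simp_all
    · rw [List.append_assoc]
      exact append_mem_kstarSet hu (ih' t ht.symm)

theorem stmt_12 {σ : Type*} (a b : σ) (hab : a ≠ b)
    (v w : List σ)
    (hv : ∀ x ∈ v, x = a ∨ x = b) (hw : ∀ x ∈ w, x = a ∨ x = b)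
    (h : v ++ [a] ++ w ∈ kstarSet ({[a], [b, a], [a, b, b]} : Set (List σ))) :
    v ++ [a] ∈ kstarSet ({[a], [b, a], [a, b, b]} : Set (List σ)) := by
  obtain ⟨W, hW, h⟩ := h
  exact append_singleton_mem_kstarSet_of_flatten hab W hW v w (by simpa using h)
end
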